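/- arXiv:2605.20952 — 2 statements merged into one kernel-verified Lean document; each statement's English description precedes it below -/
import Mathlib

section
/- Nonce reuse reveals the Schnorr private key at the group level: let G be an additive commutative group, q a prime, and g ∈ G with addOrderOf g = q. Let sk ∈ ZMod q and pk = sk.val • g. Suppose (R, s₁) and (R, s₂) are two valid Schnorr signatures sharing the same nonce point R ∈ G, with hash values h₁ ≠ h₂ in ZMod q, i.e., s₁.val • g = R + h₁.val • pk and s₂.val • g = R + h₂.val • pk. Then (s₁ − s₂) · (h₁ − h₂)⁻¹ = sk in ZMod q. -/
/-- Nonce reuse reveals the Schnorr private key at the group level: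
if `(R, s₁)` and `(R, s₂)` both verify (same nonce point `R`) with hash
values `h₁ ≠ h₂`, then `(s₁ − s₂)·(h₁ − h₂)⁻¹ = sk` in `ZMod q`. -/
theorem schnorr_nonce_reuse_group_extraction
    (G : Type*) [AddCommGroup G] (q : ℕ) (hq : q.Prime) (g : G)
    (hg : addOrderOf g = q) (sk : ZMod q) (pk : G)
    (hpk : pk = sk.val • g)
    (R : G) (s₁ s₂ h₁ h₂ : ZMod q) (hne : h₁ ≠ h₂)
    (hver₁ : s₁.val • g = R + h₁.val • pk)
    (hver₂ : s₂.val • g = R + h₂.val • pk) :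
    (s₁ - s₂) * (h₁ - h₂)⁻¹ = sk := by
  have : Fact q.Prime := ⟨hq⟩
  have hmul : (s₁.val + h₂.val * sk.val) • g = (s₂.val + h₁.val * sk.val) • g := by
    rw [add_nsmul, add_nsmul, mul_nsmul', mul_nsmul', ← hpk, hver₁, hver₂]
    abel
  have hmod : s₁.val + h₂.val * sk.val ≡ s₂.val + h₁.val * sk.val [MOD q] := by
    rwa [nsmul_eq_nsmul_iff_modEq, hg] at hmul
  have hfield : s₁ + h₂ * sk = s₂ + h₁ * sk := by
    simpa using (ZMod.natCast_eq_natCast_iff _ _ q).mpr hmod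
  rw [← div_eq_mul_inv, div_eq_iff (sub_ne_zero.mpr hne)]
  linear_combination hfield
end

section
/- Operator balance accounting identity (algebraic core of Operator Balance Security, Lemma C.6): let k_h ≤ k_e be natural numbers, let V, U : ℕ → ℕ → ℝ and L, M, Eᵁ, X, F, Eᴹ, Sᴹ, Sᴼ : ℕ → ℝ. Assume: (i) commitment conservation: for every j ≤ k_e, L j = (∑_{i<j} V i j) + (∑_{i<j} U i j) + M j; (ii) V-support: V i j = 0 whenever j > k_h; (iii) U-support: U i j = 0 whenever i > k_h or j > k_e; (iv) VTXO conservation: for every j ≤ k_h, ∑_{i≤j} V i j = (∑_{κ=j+1}^{k_h} V j κ) + (∑_{κ=j+1}^{k_e} U j κ) + Eᵁ j + X j + F j; (v) sweep accounting: for every j ≤ k_h, Sᴼ j = (∑_{i≤j} V i j) − Eᵁ j − Eᴹ j − Sᴹ j; (vi) Sᴼ j = 0 for j > k_h. Then (∑_{j=0}^{k_e} Sᴼ j) − (∑_{j=0}^{k_e} L j) = (∑_{j=0}^{k_h} (X j + F j − Eᴹ j − Sᴹ j)) − (∑_{j=0}^{k_e} M j). -/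
open Finset

/-- Exchanging the order of summation over the pairs `i < j ≤ n`. -/
theorem sum_range_sum_range_eq_sum_sum_Icc (f : ℕ → ℕ → ℝ) (n : ℕ) :
    ∑ j ∈ range (n + 1), ∑ i ∈ range j, f i j
      = ∑ i ∈ range (n + 1), ∑ j ∈ Icc (i + 1) n, f i j := by
  apply sum_comm'
  intro j i
  simp only [mem_range, mem_Icc]
  lia

/-- A sum over an initial segment may be truncated where the terms vanish. -/
theorem sum_range_succ_eq_of_eq_zero {m n : ℕ} (hmn : m ≤ n) {f : ℕ → ℝ}
    (hf : ∀ j, m < j → f j = 0) :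
    ∑ j ∈ range (n + 1), f j = ∑ j ∈ range (m + 1), f j := by
  symm
  apply sum_subset (range_subset_range.2 (by lia))
  intro j _ hj
  exact hf j (by simpa [Nat.lt_succ_iff] using hj)

/-- Operator balance accounting identity (algebraic core of Operator
Balance Security, Lemma C.6). -/
theorem operator_balance_accounting
    (k_h k_e : ℕ) (hk : k_h ≤ k_e)
    (V U : ℕ → ℕ → ℝ) (L M Eu X F Em Sm So : ℕ → ℝ)
    (hL : ∀ j ≤ k_e,
      L j = (∑ i ∈ range j, V i j) + (∑ i ∈ range j, U i j) + M j)
    (hV : ∀ i j, k_h < j → V i j = 0)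
    (hU : ∀ i j, k_h < i ∨ k_e < j → U i j = 0)
    (hVtxo : ∀ j ≤ k_h,
      (∑ i ∈ range (j + 1), V i j)
        = (∑ κ ∈ Icc (j + 1) k_h, V j κ) + (∑ κ ∈ Icc (j + 1) k_e, U j κ)
          + Eu j + X j + F j)
    (hSo : ∀ j ≤ k_h,
      So j = (∑ i ∈ range (j + 1), V i j) - Eu j - Em j - Sm j)
    (hSo0 : ∀ j, k_h < j → So j = 0) :
    (∑ j ∈ range (k_e + 1), So j) - (∑ j ∈ range (k_e + 1), L j)
      = (∑ j ∈ range (k_h + 1), (X j + F j - Em j - Sm j))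
        - (∑ j ∈ range (k_e + 1), M j) := by
  have sum_L : ∑ j ∈ range (k_e + 1), L j
      = (∑ j ∈ range (k_h + 1), ∑ κ ∈ Icc (j + 1) k_h, V j κ)
        + (∑ j ∈ range (k_h + 1), ∑ κ ∈ Icc (j + 1) k_e, U j κ)
        + ∑ j ∈ range (k_e + 1), M j := by
    rw [sum_congr rfl fun j hj => hL j (Nat.lt_succ_iff.1 (mem_range.1 hj)),
      sum_add_distrib, sum_add_distrib,
      sum_range_succ_eq_of_eq_zero hk fun j hj => sum_eq_zero fun i _ => hV i j hj,
      sum_range_sum_range_eq_sum_sum_Icc V, sum_range_sum_range_eq_sum_sum_Icc U,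
      sum_range_succ_eq_of_eq_zero hk fun j hj => sum_eq_zero fun κ _ => hU j κ (Or.inl hj)]
  have sum_So : ∑ j ∈ range (k_e + 1), So j
      = (∑ j ∈ range (k_h + 1), ∑ κ ∈ Icc (j + 1) k_h, V j κ)
        + (∑ j ∈ range (k_h + 1), ∑ κ ∈ Icc (j + 1) k_e, U j κ)
        + ∑ j ∈ range (k_h + 1), (X j + F j - Em j - Sm j) := by
    rw [sum_range_succ_eq_of_eq_zero hk hSo0, ← sum_add_distrib, ← sum_add_distrib]
    refine sum_congr rfl fun j hj => ?_
    have hj' : j ≤ k_h := Nat.lt_succ_iff.1 (mem_range.1 hj)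
    rw [hSo j hj', hVtxo j hj']
    ring
  rw [sum_So, sum_L]
  ring
end
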